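/- Let φ(z) = (1/√(2π))·exp(−z²/2), let c₁, c₂ > 0, and define ELBO(θ) = ∫_ℝ φ(z−θ)·log(r(z)/φ(z−θ)) dz where r(z) = 𝟙{z>0}·c₁·φ(z) + 𝟙{z≤0}·c₂·φ(z). Then ELBO is differentiable on ℝ and for every θ ∈ ℝ, ELBO′(θ) = −θ + log(c₁/c₂)·exp(−θ²/2)/√(2π). -/

import Mathlib

open MeasureTheory Real

/-- The standard normal density. -/
noncomputable def stdNormal (z : ℝ) : ℝ :=
  (1 / Real.sqrt (2 * Real.pi)) * Real.exp (-z ^ 2 / 2)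

/-- The unnormalized posterior `r(z) = 𝟙{z>0}·c₁·φ(z) + 𝟙{z≤0}·c₂·φ(z)`. -/
noncomputable def rPost (c₁ c₂ : ℝ) (z : ℝ) : ℝ :=
  (if z > 0 then (1 : ℝ) else 0) * c₁ * stdNormal z +
  (if z ≤ 0 then (1 : ℝ) else 0) * c₂ * stdNormal z

/-- `ELBO(θ) = ∫ φ(z−θ)·log(r(z)/φ(z−θ)) dz`. -/
noncomputable def elbo (c₁ c₂ : ℝ) (θ : ℝ) : ℝ :=
  ∫ z : ℝ, stdNormal (z - θ) * Real.log (rPost c₁ c₂ z / stdNormal (z - θ))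

lemma stdNormal_eq_gaussianPDFReal : stdNormal = ProbabilityTheory.gaussianPDFReal 0 1 := by
  ext z
  simp [stdNormal, ProbabilityTheory.gaussianPDFReal]

lemma stdNormal_pos (z : ℝ) : 0 < stdNormal z := by
  unfold stdNormal; positivity

lemma stdNormal_neg (z : ℝ) : stdNormal (-z) = stdNormal z := by
  simp [stdNormal]

lemma continuous_stdNormal : Continuous stdNormal := by
  unfold stdNormal; fun_prop

lemma integrable_stdNormal : Integrable stdNormal := by
  rw [stdNormal_eq_gaussianPDFReal]
  exact ProbabilityTheory.integrable_gaussianPDFReal 0 1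

lemma integral_stdNormal : ∫ z, stdNormal z = 1 := by
  rw [stdNormal_eq_gaussianPDFReal]
  exact ProbabilityTheory.integral_gaussianPDFReal_eq_one 0 one_ne_zero

lemma integrable_mul_stdNormal : Integrable fun z => z * stdNormal z := by
  convert (integrable_mul_exp_neg_mul_sq (b := 1 / 2) (by norm_num)).const_mul
    (1 / Real.sqrt (2 * Real.pi)) using 2 with z
  rw [stdNormal, show -z ^ 2 / 2 = -(1 / 2) * z ^ 2 by ring]
  ring

lemma integral_mul_stdNormal : ∫ z, z * stdNormal z = 0 := by
  have h := integral_neg_eq_self (fun z => z * stdNormal z) volume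
  simp only [stdNormal_neg, neg_mul, integral_neg] at h
  linarith

lemma log_stdNormal (z : ℝ) :
    Real.log (stdNormal z) = Real.log (1 / Real.sqrt (2 * Real.pi)) - z ^ 2 / 2 := by
  rw [stdNormal, Real.log_mul (by positivity) (Real.exp_ne_zero _), Real.log_exp]
  ring

lemma log_rPost {c₁ c₂ : ℝ} (hc₁ : 0 < c₁) (hc₂ : 0 < c₂) (z : ℝ) :
    Real.log (rPost c₁ c₂ z) =
      Real.log c₂ + (Set.Ioi 0).indicator (fun _ => Real.log (c₁ / c₂)) z
        + Real.log (stdNormal z) := by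
  have hz := (stdNormal_pos z).ne'
  rcases lt_or_ge 0 z with h | h
  · simp [rPost, h, h.not_ge, Real.log_mul hc₁.ne' hz, Real.log_div hc₁.ne' hc₂.ne']
  · simp [rPost, h, h.not_gt, Real.log_mul hc₂.ne' hz]

lemma rPost_pos {c₁ c₂ : ℝ} (hc₁ : 0 < c₁) (hc₂ : 0 < c₂) (z : ℝ) : 0 < rPost c₁ c₂ z := by
  have hz := stdNormal_pos z
  rcases lt_or_ge 0 z with h | h
  · simpa [rPost, h, h.not_ge] using mul_pos hc₁ hz
  · simpa [rPost, h, h.not_gt] using mul_pos hc₂ hz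

/-- Closed form of the ELBO in terms of the normal distribution function. -/
lemma elbo_eq {c₁ c₂ : ℝ} (hc₁ : 0 < c₁) (hc₂ : 0 < c₂) (θ : ℝ) :
    elbo c₁ c₂ θ = Real.log c₂ - θ ^ 2 / 2
      + Real.log (c₁ / c₂) * ∫ z in Set.Iic θ, stdNormal z := by
  have hintegrand (z : ℝ) :
      stdNormal z * Real.log (rPost c₁ c₂ (z + θ) / stdNormal z) =
        (Real.log c₂ - θ ^ 2 / 2) * stdNormal z - θ * (z * stdNormal z)
          + Real.log (c₁ / c₂) * (Set.Ioi (-θ)).indicator stdNormal z := by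
    rw [Real.log_div (rPost_pos hc₁ hc₂ _).ne' (stdNormal_pos _).ne', log_rPost hc₁ hc₂,
      log_stdNormal, log_stdNormal]
    by_cases h : -θ < z
    · have h' : 0 < z + θ := by linarith
      simp only [Set.indicator, Set.mem_Ioi, h, h', if_true]
      ring
    · have h' : ¬ 0 < z + θ := by linarith
      simp only [Set.indicator, Set.mem_Ioi, h, h', if_false]
      ring
  have hshift := integral_sub_right_eq_self (μ := volume)
    (fun z => stdNormal z * Real.log (rPost c₁ c₂ (z + θ) / stdNormal z)) θ
  simp only [sub_add_cancel] at hshift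
  have hIoi : ∫ z in Set.Ioi (-θ), stdNormal z = ∫ z in Set.Iic θ, stdNormal z := by
    simpa only [stdNormal_neg] using (integral_comp_neg_Iic θ stdNormal).symm
  have hint₀ := integrable_stdNormal.const_mul (Real.log c₂ - θ ^ 2 / 2)
  have hint₁ := integrable_mul_stdNormal.const_mul θ
  have hint₂ := (integrable_stdNormal.indicator (measurableSet_Ioi (a := -θ))).const_mul
    (Real.log (c₁ / c₂))
  have hint₀₁ : Integrable fun z =>
      (Real.log c₂ - θ ^ 2 / 2) * stdNormal z - θ * (z * stdNormal z) := hint₀.sub hint₁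
  rw [elbo, hshift]
  simp_rw [hintegrand]
  rw [integral_add hint₀₁ hint₂, integral_sub hint₀ hint₁]
  simp only [integral_const_mul]
  rw [integral_stdNormal, integral_mul_stdNormal, integral_indicator measurableSet_Ioi, hIoi]
  ring

lemma hasDerivAt_integral_Iic_stdNormal (θ : ℝ) :
    HasDerivAt (fun t => ∫ z in Set.Iic t, stdNormal z) (stdNormal θ) θ := by
  have hsplit : (fun t => ∫ z in Set.Iic t, stdNormal z) =
      fun t => (∫ z in Set.Iic 0, stdNormal z) + ∫ z in (0 : ℝ)..t, stdNormal z := by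
    ext t
    rw [← intervalIntegral.integral_Iic_sub_Iic integrable_stdNormal.integrableOn
      integrable_stdNormal.integrableOn]
    ring
  rw [hsplit]
  exact (continuous_stdNormal.integral_hasStrictDerivAt 0 θ).hasDerivAt.const_add _

lemma hasDerivAt_elbo {c₁ c₂ : ℝ} (hc₁ : 0 < c₁) (hc₂ : 0 < c₂) (θ : ℝ) :
    HasDerivAt (elbo c₁ c₂) (-θ + Real.log (c₁ / c₂) * stdNormal θ) θ := by
  rw [funext (elbo_eq hc₁ hc₂)]
  have hsq : HasDerivAt (fun t : ℝ => Real.log c₂ - t ^ 2 / 2) (-θ) θ :=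
    (((hasDerivAt_pow 2 θ).div_const 2).const_sub (Real.log c₂)).congr_deriv (by norm_num)
  exact hsq.add ((hasDerivAt_integral_Iic_stdNormal θ).const_mul _)

theorem elbo_deriv (c₁ c₂ : ℝ) (hc₁ : 0 < c₁) (hc₂ : 0 < c₂) :
    Differentiable ℝ (elbo c₁ c₂) ∧
    ∀ θ : ℝ, deriv (elbo c₁ c₂) θ =
      -θ + Real.log (c₁ / c₂) * Real.exp (-θ ^ 2 / 2) / Real.sqrt (2 * Real.pi) := by
  refine ⟨fun θ => (hasDerivAt_elbo hc₁ hc₂ θ).differentiableAt, fun θ => ?_⟩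
  rw [(hasDerivAt_elbo hc₁ hc₂ θ).deriv, stdNormal]
  ring
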